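/- There exists an absolute constant c > 0 such that the following holds: for every ε > 0 there is p₀ such that for every prime p ≥ p₀, if A is a random subset of ℤ_p obtained by including each element independently with probability q = 1/√p and k = ⌈c·log p⌉, then with probability at least 1 − ε there is no arithmetic progression b₁, b₂, …, b_k of length k in ℤ_p together with pairs (a_i, a′_i) ∈ A × A satisfying a_i + a′_i = b_i for every 1 ≤ i ≤ k, in which no element of A occurs more than 4 times in total among the 2k entries a₁, a′₁, …, a_k, a′_k. -/

import Mathlib

open scoped Classical
open Finset

section BernoulliSubset

variable {α : Type*} [Fintype α]

/-- The probability that a random subset of `α`, containing each element independently with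
probability `q`, satisfies `Q`. -/
noncomputable def bernoulliProb (q : ℝ) (Q : Finset α → Prop) : ℝ :=
  ∑ A ∈ (univ : Finset α).powerset,
    if Q A then q ^ A.card * (1 - q) ^ (Fintype.card α - A.card) else 0

variable {q : ℝ}

lemma bernoulliProb_add_not (q : ℝ) (Q : Finset α → Prop) :
    bernoulliProb q Q + bernoulliProb q (fun A => ¬ Q A) = 1 := by
  unfold bernoulliProb
  rw [← sum_add_distrib]
  trans ∑ A ∈ (univ : Finset α).powerset, q ^ A.card * (1 - q) ^ ((univ : Finset α).card - A.card)
  · refine sum_congr rfl fun A _ => ?_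
    by_cases h : Q A <;> simp [h]
  · rw [sum_pow_mul_eq_add_pow]
    simp

lemma bernoulliProb_mono (h0 : 0 ≤ q) (h1 : q ≤ 1) {Q R : Finset α → Prop}
    (h : ∀ A, Q A → R A) : bernoulliProb q Q ≤ bernoulliProb q R := by
  unfold bernoulliProb
  refine sum_le_sum fun A _ => ?_
  have h2 : 0 ≤ 1 - q := by linarith
  have hw : 0 ≤ q ^ A.card * (1 - q) ^ (Fintype.card α - A.card) := by positivity
  by_cases hQ : Q A
  · simp [hQ, h A hQ]
  · by_cases hR : R A <;> simp [hQ, hR, hw]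

lemma bernoulliProb_or_le (h0 : 0 ≤ q) (h1 : q ≤ 1) (Q R : Finset α → Prop) :
    bernoulliProb q (fun A => Q A ∨ R A) ≤ bernoulliProb q Q + bernoulliProb q R := by
  unfold bernoulliProb
  rw [← sum_add_distrib]
  refine sum_le_sum fun A _ => ?_
  have h2 : 0 ≤ 1 - q := by linarith
  have hw : 0 ≤ q ^ A.card * (1 - q) ^ (Fintype.card α - A.card) := by positivity
  by_cases hQ : Q A <;> by_cases hR : R A <;> simp [hQ, hR, hw]

lemma bernoulliProb_exists_mem_le (h0 : 0 ≤ q) (h1 : q ≤ 1) {β : Type*} (s : Finset β)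
    (Q : β → Finset α → Prop) :
    bernoulliProb q (fun A => ∃ i ∈ s, Q i A) ≤ ∑ i ∈ s, bernoulliProb q (Q i) := by
  induction s using Finset.induction_on with
  | empty => simp [bernoulliProb]
  | insert i s hi ih =>
    rw [sum_insert hi]
    simp only [exists_mem_insert]
    exact (bernoulliProb_or_le h0 h1 _ _).trans (by gcongr)

lemma bernoulliProb_superset (q : ℝ) (T : Finset α) :
    bernoulliProb q (fun A => T ⊆ A) = q ^ T.card := by
  have h := prod_add (fun _ : α => q) (fun x => if x ∈ T then 0 else 1 - q) univ
  have hl : ∏ x : α, (q + if x ∈ T then 0 else 1 - q) = q ^ T.card := by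
    trans ∏ x : α, if x ∈ T then q else 1
    · refine prod_congr rfl fun x _ => ?_
      split_ifs <;> ring
    · simp
  rw [← hl, h]
  refine sum_congr rfl fun A _ => ?_
  by_cases hT : T ⊆ A
  · have : ∏ x ∈ univ \ A, (if x ∈ T then 0 else 1 - q) = ∏ x ∈ univ \ A, (1 - q) :=
      prod_congr rfl fun x hx => if_neg fun hxT => (mem_sdiff.1 hx).2 (hT hxT)
    rw [this, if_pos hT]
    simp [card_sdiff]
  · obtain ⟨x, hx, hxA⟩ := not_subset.1 hT
    rw [if_neg hT, prod_eq_zero (i := x) (s := univ \ A) (by simp [hxA]) (by simp [hx]), mul_zero]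

/-- A union bound of van den Berg–Kesten type: the probability that a random set contains pairwise
disjoint members, one from each of the families `𝓤 i`. -/
lemma bernoulliProb_disjoint_members_le (h0 : 0 ≤ q) (h1 : q ≤ 1) {ι : Type*} [Fintype ι]
    (𝓤 : ι → Finset (Finset α)) :
    bernoulliProb q (fun A => ∃ u : ι → Finset α, (∀ i, u i ∈ 𝓤 i ∧ u i ⊆ A) ∧
      Pairwise fun i j => Disjoint (u i) (u j)) ≤ ∏ i, ∑ v ∈ 𝓤 i, q ^ v.card := by
  rw [prod_univ_sum]
  calc _ ≤ bernoulliProb q (fun A => ∃ u ∈ (Fintype.piFinset 𝓤).filter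
        (fun u => Pairwise fun i j => Disjoint (u i) (u j)), univ.biUnion u ⊆ A) := by
        refine bernoulliProb_mono h0 h1 fun A ⟨u, hu, hd⟩ => ⟨u, ?_, ?_⟩
        · simp [hd, fun i => (hu i).1]
        · exact biUnion_subset.2 fun i _ => (hu i).2
    _ ≤ _ := bernoulliProb_exists_mem_le h0 h1 _ _
    _ ≤ ∑ u ∈ (Fintype.piFinset 𝓤).filter
        (fun u => Pairwise fun i j => Disjoint (u i) (u j)), ∏ i, q ^ (u i).card := by
        refine sum_le_sum fun u hu => ?_
        rw [bernoulliProb_superset, card_biUnion fun i _ j _ hij => (mem_filter.1 hu).2 hij,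
          prod_pow_eq_pow_sum]
    _ ≤ _ := sum_le_sum_of_subset_of_nonneg (filter_subset _ _)
        fun u _ _ => prod_nonneg fun i _ => by positivity

end BernoulliSubset

/-- In a family of sets of maximum degree `4`, either all but `12 t` of the sets form a matching,
or there are `t` pairwise disjoint obstructions to being a matching. -/
lemma exists_matching_or_disjoint_obstructions {α ι : Type*} (V : ι → Finset α)
    (𝓤 : Finset (Finset α))
    (hdeg : ∀ (S : Finset ι) (x : α), (S.filter fun i => x ∈ V i).card ≤ 4)
    (hcard : ∀ u ∈ 𝓤, u.card ≤ 3)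
    (hobs : ∀ S : Finset ι,
      ((∀ i ∈ S, (V i).card = 2) ∧ ∀ i ∈ S, ∀ j ∈ S, i ≠ j → Disjoint (V i) (V j)) ∨
        ∃ u ∈ 𝓤, u ⊆ S.biUnion V) (t : ℕ) (S : Finset ι) :
    (∃ S' ⊆ S, S.card ≤ S'.card + 12 * t ∧ (∀ i ∈ S', (V i).card = 2) ∧
        ∀ i ∈ S', ∀ j ∈ S', i ≠ j → Disjoint (V i) (V j)) ∨
      ∃ u : Fin t → Finset α, (∀ s, u s ∈ 𝓤 ∧ u s ⊆ S.biUnion V) ∧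
        Pairwise fun s r => Disjoint (u s) (u r) := by
  induction t generalizing S with
  | zero => exact Or.inr ⟨fun s => s.elim0, fun s => s.elim0, fun s => s.elim0⟩
  | succ t ih =>
    rcases hobs S with h | ⟨u, hu, huS⟩
    · exact Or.inl ⟨S, Subset.rfl, by omega, h.1, h.2⟩
    set R := S.filter fun i => Disjoint u (V i) with hR
    have hRS : R ⊆ S := filter_subset _ _
    have hloss : S.card ≤ R.card + 12 := by
      have h2 : (S.filter fun i => ¬ Disjoint u (V i)).card ≤ 12 := by
        calc _ ≤ (u.biUnion fun x => S.filter fun i => x ∈ V i).card := by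
              refine card_le_card fun i hi => ?_
              obtain ⟨hi, hd⟩ := mem_filter.1 hi
              obtain ⟨x, hxu, hx⟩ := not_disjoint_iff.1 hd
              exact mem_biUnion.2 ⟨x, hxu, mem_filter.2 ⟨hi, hx⟩⟩
          _ ≤ u.card * 4 := card_biUnion_le_card_mul _ _ _ fun x _ => hdeg S x
          _ ≤ 12 := by have := hcard u hu; omega
      have := card_filter_add_card_filter_not (s := S) (fun i => Disjoint u (V i))
      rw [hR]
      omega
    rcases ih R with ⟨S', hS', hc, h⟩ | ⟨w, hw, hd⟩
    · exact Or.inl ⟨S', hS'.trans hRS, by omega, h⟩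
    · have huw : ∀ s, Disjoint u (w s) := fun s =>
        Disjoint.mono_right (hw s).2 <| (disjoint_biUnion_right _ _ _).2 fun i hi =>
          (mem_filter.1 hi).2
      refine Or.inr ⟨Fin.cons u w, fun s => ?_, fun s r => ?_⟩
      · refine Fin.cases ⟨hu, huS⟩ (fun s => ?_) s
        exact ⟨(hw s).1, (hw s).2.trans (biUnion_subset_biUnion_of_subset_left _ hRS)⟩
      · refine Fin.cases ?_ (fun s => ?_) s <;> refine Fin.cases ?_ (fun r => ?_) r
        · simp
        · exact fun _ => huw r
        · exact fun _ => (huw s).symm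
        · intro hsr
          exact hd fun h => hsr (congrArg Fin.succ h)

lemma sum_half_pow_card_le (k m : ℕ) :
    ∑ S : Finset (Fin k) with k ≤ S.card + m, (1 / 2 : ℝ) ^ S.card ≤ 4 ^ m * (3 / 4) ^ k := by
  have h := sum_pow_mul_eq_add_pow (1 / 2 : ℝ) (1 / 4) (univ : Finset (Fin k))
  rw [card_univ, Fintype.card_fin, powerset_univ] at h
  norm_num at h
  rw [show (3 / 4 : ℝ) ^ k = _ from h.symm, mul_sum]
  refine (sum_le_sum fun S hS => ?_).trans
    (sum_le_sum_of_subset_of_nonneg (filter_subset _ _) fun S _ _ => by positivity)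
  have hS' : k - S.card ≤ m := by have := (mem_filter.1 hS).2; omega
  have h4 : (4 : ℝ) ^ (k - S.card) ≤ 4 ^ m := pow_le_pow_right₀ (by norm_num) hS'
  have h5 : (4 : ℝ) ^ (k - S.card) * (1 / 4) ^ (k - S.card) = 1 := by
    rw [← mul_pow]; norm_num
  calc (1 / 2 : ℝ) ^ S.card
      = (1 / 2) ^ S.card * (4 ^ (k - S.card) * (1 / 4) ^ (k - S.card)) := by rw [h5, mul_one]
    _ ≤ (1 / 2) ^ S.card * (4 ^ m * (1 / 4) ^ (k - S.card)) := by gcongr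
    _ = _ := by ring

section SumPairs

variable {G : Type*} [AddCommGroup G] [Fintype G]

/-- The two-element subsets of `G` with sum `y`. -/
noncomputable def sumPairs (y : G) : Finset (Finset G) :=
  (univ.image fun x => ({x, y - x} : Finset G)).filter fun u => u.card = 2

lemma sum_sumPairs_le {q : ℝ} (hq : q ^ 2 * Fintype.card G ≤ 1) (y : G) :
    ∑ v ∈ sumPairs y, q ^ v.card ≤ 1 / 2 := by
  have hc : ∀ v ∈ sumPairs y, v.card = 2 := fun v hv => (mem_filter.1 hv).2
  have hrep : ∀ v ∈ sumPairs y, ∀ z ∈ v, v = {z, y - z} := by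
    intro v hv z hz
    obtain ⟨x, -, rfl⟩ := mem_image.1 (mem_filter.1 hv).1
    rcases mem_insert.1 hz with rfl | hz
    · rfl
    · rw [mem_singleton.1 hz, sub_sub_cancel, pair_comm]
  have hcard : (sumPairs y).card * 2 ≤ Fintype.card G := by
    rw [← sum_const_nat hc, ← card_biUnion (t := fun v : Finset G => v)]
    · exact card_le_univ _
    · intro v hv w hw hvw
      refine disjoint_left.2 fun z hzv hzw => hvw ?_
      rw [hrep v hv z hzv, hrep w hw z hzw]
  rw [sum_congr rfl fun v hv => by rw [hc v hv], sum_const, nsmul_eq_mul]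
  have hcard' : ((sumPairs y).card : ℝ) * 2 ≤ Fintype.card G := by exact_mod_cast hcard
  nlinarith [sq_nonneg q]

variable {k : ℕ}

/-- The vertex sets of loops, and of pairs of adjacent edges, in the graph on `G` whose edges are
the pairs with sum in the range of `f`. -/
noncomputable def loopsAndCherries (f : Fin k → G) : Finset (Finset G) :=
  ((univ.filter fun z : Fin k × G => z.2 + z.2 = f z.1).image fun z => {z.2}) ∪
    (univ.image fun z : Fin k × Fin k × G =>
      ({z.2.2, f z.1 - z.2.2, f z.2.1 - z.2.2} : Finset G)).filter fun u => u.card = 3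

lemma card_le_of_mem_loopsAndCherries {f : Fin k → G} {u : Finset G}
    (hu : u ∈ loopsAndCherries f) : u.card ≤ 3 := by
  rcases mem_union.1 hu with hu | hu
  · obtain ⟨z, -, rfl⟩ := mem_image.1 hu
    simp
  · exact (mem_filter.1 hu).2.le

lemma sum_loopsAndCherries_le {q : ℝ} (h0 : 0 ≤ q) (hq : q ^ 2 * Fintype.card G ≤ 1)
    (hG : ∀ x y : G, x + x = y + y → x = y) (f : Fin k → G) :
    ∑ v ∈ loopsAndCherries f, q ^ v.card ≤ (k + k ^ 2) * q := by
  set L := (univ.filter fun z : Fin k × G => z.2 + z.2 = f z.1).image fun z => ({z.2} : Finset G)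
    with hL
  set C := (univ.image fun z : Fin k × Fin k × G =>
      ({z.2.2, f z.1 - z.2.2, f z.2.1 - z.2.2} : Finset G)).filter fun u => u.card = 3 with hC
  have hLc : L.card ≤ k := by
    refine card_image_le.trans ?_
    have : Set.InjOn (Prod.fst : Fin k × G → Fin k)
        ((univ.filter fun z : Fin k × G => z.2 + z.2 = f z.1 : Finset (Fin k × G)) :
          Set (Fin k × G)) := by
      intro z hz w hw h
      simp only [coe_filter, mem_univ, true_and, Set.mem_ofPred_eq] at hz hw
      exact Prod.ext h (hG _ _ (by rw [hz, hw, h]))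
    simpa using card_le_card_of_injOn _ (fun _ _ => mem_univ _) this
  have hCc : C.card ≤ k * (k * Fintype.card G) := by
    refine (card_filter_le _ _).trans (card_image_le.trans ?_)
    simp
  have hLs : ∑ v ∈ L, q ^ v.card = L.card * q := by
    rw [← nsmul_eq_mul, ← sum_const]
    refine sum_congr rfl fun v hv => ?_
    obtain ⟨z, -, rfl⟩ := mem_image.1 hv
    simp
  have hCs : ∑ v ∈ C, q ^ v.card = C.card * q ^ 3 := by
    rw [← nsmul_eq_mul, ← sum_const]
    exact sum_congr rfl fun v hv => by rw [(mem_filter.1 hv).2]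
  have hLc' : (L.card : ℝ) ≤ k := by exact_mod_cast hLc
  have hCc' : (C.card : ℝ) ≤ k * (k * Fintype.card G) := by exact_mod_cast hCc
  calc ∑ v ∈ loopsAndCherries f, q ^ v.card
      ≤ ∑ v ∈ L ∪ C, q ^ v.card + ∑ v ∈ L ∩ C, q ^ v.card :=
        le_add_of_nonneg_right (sum_nonneg fun v _ => by positivity)
    _ = L.card * q + C.card * q ^ 3 := by rw [sum_union_inter, hLs, hCs]
    _ ≤ k * q + k * (k * Fintype.card G) * q ^ 3 := by gcongr
    _ = k * q + k ^ 2 * q * (q ^ 2 * Fintype.card G) := by ring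
    _ ≤ k * q + k ^ 2 * q * 1 := by gcongr
    _ = _ := by ring

/-- `A` represents every `f i` as a sum of two of its elements, using each element at most
`4` times in total. -/
def HasSparseRepresentation (f : Fin k → G) (A : Finset G) : Prop :=
  ∃ a a' : Fin k → G, (∀ i, a i ∈ A ∧ a' i ∈ A ∧ a i + a' i = f i) ∧
    ∀ x, (univ.filter fun i => a i = x).card + (univ.filter fun i => a' i = x).card ≤ 4

lemma HasSparseRepresentation.exists_matching_or {f : Fin k → G} (hf : f.Injective)
    {A : Finset G} (h : HasSparseRepresentation f A) (t : ℕ) :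
    (∃ S ∈ univ.filter fun S : Finset (Fin k) => k ≤ S.card + 12 * t,
      ∃ u : S → Finset G, (∀ i : S, u i ∈ sumPairs (f i) ∧ u i ⊆ A) ∧
        Pairwise fun i j => Disjoint (u i) (u j)) ∨
      ∃ u : Fin t → Finset G, (∀ s, u s ∈ loopsAndCherries f ∧ u s ⊆ A) ∧
        Pairwise fun s r => Disjoint (u s) (u r) := by
  obtain ⟨a, a', ha, hdeg⟩ := h
  set V : Fin k → Finset G := fun i => {a i, a' i} with hV
  have hVA : ∀ i, V i ⊆ A := fun i x hx => by
    rcases mem_insert.1 hx with rfl | hx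
    · exact (ha i).1
    · rw [mem_singleton.1 hx]; exact (ha i).2.1
  have hVrep : ∀ i, ∀ x ∈ V i, V i = {x, f i - x} := by
    intro i x hx
    rw [← (ha i).2.2]
    rcases mem_insert.1 hx with rfl | hx
    · simp [hV]
    · rw [mem_singleton.1 hx, add_sub_cancel_right, pair_comm]
  have hdeg' : ∀ (S : Finset (Fin k)) (x : G), (S.filter fun i => x ∈ V i).card ≤ 4 := by
    intro S x
    refine le_trans (le_trans (card_le_card fun i hi => ?_) (card_union_le _ _)) (hdeg x)
    have := (mem_filter.1 hi).2
    simp only [hV, mem_insert, mem_singleton] at this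
    simp only [mem_union, mem_filter, mem_univ, true_and]
    exact this.imp Eq.symm Eq.symm
  have hobs : ∀ S : Finset (Fin k),
      ((∀ i ∈ S, (V i).card = 2) ∧ ∀ i ∈ S, ∀ j ∈ S, i ≠ j → Disjoint (V i) (V j)) ∨
        ∃ u ∈ loopsAndCherries f, u ⊆ S.biUnion V := by
    intro S
    by_cases hloop : ∃ i ∈ S, a i = a' i
    · obtain ⟨i, hi, haa⟩ := hloop
      refine Or.inr ⟨{a i}, mem_union_left _ (mem_image.2 ⟨(i, a i), ?_, rfl⟩), ?_⟩
      · simpa [← haa] using (ha i).2.2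
      · exact singleton_subset_iff.2 (mem_biUnion.2 ⟨i, hi, by simp [hV]⟩)
    push Not at hloop
    have hV2 : ∀ i ∈ S, (V i).card = 2 := fun i hi => card_pair (hloop i hi)
    by_cases hd : ∀ i ∈ S, ∀ j ∈ S, i ≠ j → Disjoint (V i) (V j)
    · exact Or.inl ⟨hV2, hd⟩
    push Not at hd
    obtain ⟨i, hi, j, hj, hij, hd⟩ := hd
    obtain ⟨x, hxi, hxj⟩ := not_disjoint_iff.1 hd
    have hi' := hVrep i x hxi
    have hj' := hVrep j x hxj
    have hne : ∀ l ∈ S, V l = {x, f l - x} → x ≠ f l - x := by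
      intro l hl h he
      have := hV2 l hl
      rw [h, ← he] at this
      simp at this
    refine Or.inr ⟨{x, f i - x, f j - x}, mem_union_right _ (mem_filter.2
      ⟨mem_image.2 ⟨(i, j, x), mem_univ _, rfl⟩, ?_⟩), ?_⟩
    · exact card_eq_three.2 ⟨x, f i - x, f j - x, hne i hi hi', hne j hj hj',
        fun h => hij (hf (sub_left_injective h)), rfl⟩
    · intro z hz
      simp only [mem_insert, mem_singleton] at hz
      rcases hz with rfl | rfl | rfl
      · exact mem_biUnion.2 ⟨i, hi, hxi⟩
      · exact mem_biUnion.2 ⟨i, hi, by simp [hi']⟩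
      · exact mem_biUnion.2 ⟨j, hj, by simp [hj']⟩
  rcases exists_matching_or_disjoint_obstructions V (loopsAndCherries f) hdeg'
    (fun u => card_le_of_mem_loopsAndCherries) hobs t univ with
    ⟨S, -, hc, hV2, hd⟩ | ⟨u, hu, hd⟩
  · refine Or.inl ⟨S, mem_filter.2 ⟨mem_univ _, by simpa using hc⟩, fun i => V i,
      fun i => ⟨mem_filter.2 ⟨mem_image.2 ⟨a i, mem_univ _, ?_⟩, hV2 i i.2⟩, hVA i⟩,
      fun i j hij => hd i i.2 j j.2 fun h => hij (Subtype.ext h)⟩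
    exact (hVrep i (a i) (by simp [hV])).symm
  · exact Or.inr ⟨u, fun s => ⟨(hu s).1, (hu s).2.trans (biUnion_subset.2 fun i _ => hVA i)⟩, hd⟩

lemma bernoulliProb_hasSparseRepresentation_le {q : ℝ} (h0 : 0 ≤ q) (h1 : q ≤ 1)
    (hq : q ^ 2 * Fintype.card G ≤ 1) (hG : ∀ x y : G, x + x = y + y → x = y)
    {f : Fin k → G} (hf : f.Injective) (t : ℕ) :
    bernoulliProb q (HasSparseRepresentation f) ≤
      4 ^ (12 * t) * (3 / 4) ^ k + ((k + k ^ 2) * q) ^ t := by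
  refine (bernoulliProb_mono h0 h1 fun A hA => hA.exists_matching_or hf t).trans
    ((bernoulliProb_or_le h0 h1 _ _).trans (add_le_add ?_ ?_))
  · refine (bernoulliProb_exists_mem_le h0 h1 _ _).trans
      ((sum_le_sum fun S _ => ?_).trans (sum_half_pow_card_le k (12 * t)))
    refine (bernoulliProb_disjoint_members_le h0 h1 fun i : S => sumPairs (f i)).trans ?_
    refine (prod_le_prod (fun i _ => sum_nonneg fun v _ => by positivity)
      fun (i : S) _ => sum_sumPairs_le hq (f i)).trans ?_
    simp
  · refine (bernoulliProb_disjoint_members_le h0 h1 fun _ : Fin t => loopsAndCherries f).trans ?_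
    rw [prod_const, card_univ, Fintype.card_fin]
    exact pow_le_pow_left₀ (sum_nonneg fun v _ => by positivity)
      (sum_loopsAndCherries_le h0 hq hG f) t

end SumPairs

open Filter Asymptotics in
lemma eventually_union_bound_le {ε : ℝ} (hε : 0 < ε) :
    ∀ᶠ p : ℕ in atTop, ∀ k : ℕ, k = ⌈12 * Real.log p⌉₊ →
      (p : ℝ) ^ 2 * (4 ^ (12 * 5) * (3 / 4) ^ k + ((k + k ^ 2) * (1 / Real.sqrt p)) ^ 5) ≤ ε := by
  have hlog : ∀ᶠ x : ℝ in atTop, 182 ^ 5 * Real.log x ^ 10 ≤ ε / 2 * x ^ (1 / 2 : ℝ) := by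
    have h := (isLittleO_log_rpow_rpow_atTop (10 : ℝ) (show (0 : ℝ) < 1 / 2 by norm_num)).bound
      (show 0 < ε / 2 / 182 ^ 5 by positivity)
    filter_upwards [h, eventually_ge_atTop 1] with x hx hx1
    have hl : 0 ≤ Real.log x := Real.log_nonneg hx1
    rw [Real.norm_of_nonneg (by positivity), Real.norm_of_nonneg (by positivity)] at hx
    rw [show (10 : ℝ) = (10 : ℕ) by norm_num, Real.rpow_natCast] at hx
    calc 182 ^ 5 * Real.log x ^ 10 ≤ 182 ^ 5 * (ε / 2 / 182 ^ 5 * x ^ (1 / 2 : ℝ)) := by gcongr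
      _ = _ := by ring
  have hlin : ∀ᶠ x : ℝ in atTop, 4 ^ 60 * 2 / ε ≤ x := eventually_ge_atTop _
  filter_upwards [tendsto_natCast_atTop_atTop.eventually hlog,
    tendsto_natCast_atTop_atTop.eventually hlin, eventually_ge_atTop 3] with p hp hp' hp3 k hk
  have hp0 : (0 : ℝ) < p := by positivity
  have hlog1 : 1 ≤ Real.log p := by
    rw [Real.le_log_iff_exp_le hp0]
    have : (3 : ℝ) ≤ p := by exact_mod_cast hp3
    linarith [Real.exp_one_lt_d9]
  have hk1 : 12 * Real.log p ≤ k := hk ▸ Nat.le_ceil _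
  have hk2 : (k : ℝ) ≤ 13 * Real.log p := by
    have : (k : ℝ) < 12 * Real.log p + 1 := hk ▸ Nat.ceil_lt_add_one (by positivity)
    linarith
  have hmatch : (p : ℝ) ^ 2 * (4 ^ (12 * 5) * (3 / 4) ^ k) ≤ ε / 2 := by
    have h34 : (3 / 4 : ℝ) ^ k ≤ 1 / (p : ℝ) ^ 3 := by
      calc (3 / 4 : ℝ) ^ k ≤ Real.exp (-(1 / 4)) ^ k := by
            gcongr
            linarith [Real.add_one_le_exp (-(1 / 4) : ℝ)]
        _ = Real.exp (-(k / 4)) := by rw [← Real.exp_nat_mul]; ring_nf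
        _ ≤ Real.exp (-(3 * Real.log p)) := by gcongr; linarith
        _ = 1 / (p : ℝ) ^ 3 := by
            rw [Real.exp_neg, one_div, show (3 : ℝ) = (3 : ℕ) by norm_num, Real.exp_nat_mul,
              Real.exp_log hp0]
    calc (p : ℝ) ^ 2 * (4 ^ (12 * 5) * (3 / 4) ^ k)
        ≤ (p : ℝ) ^ 2 * (4 ^ (12 * 5) * (1 / (p : ℝ) ^ 3)) := by gcongr
      _ = 4 ^ 60 / (p : ℝ) := by field_simp
      _ ≤ ε / 2 := by
          rw [div_le_iff₀ hε] at hp'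
          rw [div_le_iff₀ hp0]
          linarith
  have hobs : (p : ℝ) ^ 2 * ((k + k ^ 2) * (1 / Real.sqrt p)) ^ 5 ≤ ε / 2 := by
    have hs : 0 < Real.sqrt p := Real.sqrt_pos.2 hp0
    have hp2 : (p : ℝ) ^ 2 = Real.sqrt p ^ 4 := by
      rw [show (4 : ℕ) = 2 * 2 by norm_num, pow_mul, Real.sq_sqrt hp0.le]
    rw [← Real.sqrt_eq_rpow] at hp
    have hkk : (k : ℝ) + k ^ 2 ≤ 182 * Real.log p ^ 2 := by nlinarith
    calc (p : ℝ) ^ 2 * ((k + k ^ 2) * (1 / Real.sqrt p)) ^ 5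
        = (k + k ^ 2) ^ 5 / Real.sqrt p := by rw [hp2]; field_simp
      _ ≤ (182 * Real.log p ^ 2) ^ 5 / Real.sqrt p := by gcongr
      _ = 182 ^ 5 * Real.log p ^ 10 / Real.sqrt p := by ring
      _ ≤ ε / 2 := by rwa [div_le_iff₀ hs]
  rw [mul_add]
  linarith

/-- Claim 2 in the proof of the upper bound. For `k = ⌈c log p⌉`, whp there
is no arithmetic progression `b, b+d, …, b+(k−1)d` of `k` distinct terms together with
pairs `(aᵢ, a′ᵢ) ∈ A × A` with `aᵢ + a′ᵢ = b + i·d`, in which no element of `A` occurs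
more than `4` times in total among the `2k` entries. -/
theorem stmt15 :
    ∃ c : ℝ, 0 < c ∧
      ∀ ε : ℝ, 0 < ε →
        ∃ p₀ : ℕ, ∀ (p : ℕ) [Fact p.Prime], p₀ ≤ p →
          ∀ k : ℕ, k = ⌈c * Real.log p⌉₊ →
            (∑ A ∈ (Finset.univ : Finset (ZMod p)).powerset,
                (if ¬ ∃ (b d : ZMod p) (a a' : Fin k → ZMod p),
                      d ≠ 0 ∧
                      (Function.Injective fun i : Fin k => b + ((i : ℕ) : ZMod p) * d) ∧
                      (∀ i : Fin k,
                        a i ∈ A ∧ a' i ∈ A ∧ a i + a' i = b + ((i : ℕ) : ZMod p) * d) ∧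
                      (∀ x : ZMod p,
                        (Finset.univ.filter fun i : Fin k => a i = x).card +
                          (Finset.univ.filter fun i : Fin k => a' i = x).card ≤ 4)
                  then (1 / Real.sqrt p) ^ A.card * (1 - 1 / Real.sqrt p) ^ (p - A.card)
                  else 0))
              ≥ 1 - ε := by
  refine ⟨12, by norm_num, fun ε hε => ?_⟩
  obtain ⟨p₀, hp₀⟩ := Filter.eventually_atTop.1 (eventually_union_bound_le hε)
  refine ⟨max p₀ 3, fun p _ hp k hk => ?_⟩
  have hbound := hp₀ p ((le_max_left _ _).trans hp) k hk
  have hp3 : 3 ≤ p := (le_max_right _ _).trans hp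
  have hp1 : (1 : ℝ) ≤ p := by exact_mod_cast (by omega : 1 ≤ p)
  set q : ℝ := 1 / Real.sqrt p with hq
  have h0 : 0 ≤ q := by positivity
  have h1 : q ≤ 1 := by
    rw [hq, div_le_one (by positivity)]
    exact Real.one_le_sqrt.2 hp1
  have hq2 : q ^ 2 * Fintype.card (ZMod p) ≤ 1 := by
    rw [hq, ZMod.card, div_pow, Real.sq_sqrt (by positivity), one_pow,
      one_div_mul_cancel (by positivity)]
  have htwo : (2 : ZMod p) ≠ 0 := by
    intro h
    have : p ∣ 2 := (ZMod.natCast_eq_zero_iff 2 p).1 (by exact_mod_cast h)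
    have := Nat.le_of_dvd (by norm_num) this
    omega
  have hG : ∀ x y : ZMod p, x + x = y + y → x = y := fun x y h =>
    mul_left_cancel₀ htwo (by rw [two_mul, two_mul, h])
  set ap : ZMod p × ZMod p → Fin k → ZMod p := fun z i => z.1 + ((i : ℕ) : ZMod p) * z.2 with hap
  set bad : Finset (ZMod p) → Prop := fun A =>
    ∃ z ∈ (univ : Finset (ZMod p × ZMod p)).filter fun z => (ap z).Injective,
      HasSparseRepresentation (ap z) A with hbad
  have hprob : bernoulliProb q bad ≤ ε := by
    refine ((bernoulliProb_exists_mem_le h0 h1 _ _).trans (sum_le_card_nsmul _ _ _ fun z hz =>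
      bernoulliProb_hasSparseRepresentation_le h0 h1 hq2 hG (mem_filter.1 hz).2 5)).trans ?_
    rw [nsmul_eq_mul]
    refine le_trans (mul_le_mul_of_nonneg_right ?_ (by positivity)) hbound
    have : (univ.filter fun z => (ap z).Injective).card ≤ p ^ 2 :=
      (card_filter_le _ _).trans (by simp [ZMod.card, sq])
    exact_mod_cast this
  have hgood : 1 - ε ≤ bernoulliProb q fun A => ¬ bad A := by
    linarith [bernoulliProb_add_not q bad]
  refine ge_iff_le.2 (hgood.trans ((bernoulliProb_mono h0 h1
    (R := fun A => ¬ ∃ (b d : ZMod p) (a a' : Fin k → ZMod p), d ≠ 0 ∧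
      (Function.Injective fun i : Fin k => b + ((i : ℕ) : ZMod p) * d) ∧
      (∀ i : Fin k, a i ∈ A ∧ a' i ∈ A ∧ a i + a' i = b + ((i : ℕ) : ZMod p) * d) ∧
      (∀ x : ZMod p, (Finset.univ.filter fun i : Fin k => a i = x).card +
        (Finset.univ.filter fun i : Fin k => a' i = x).card ≤ 4)) fun A hA => ?_).trans_eq ?_))
  · rintro ⟨b, d, a, a', -, hinj, ha, hdeg⟩
    refine hA ⟨(b, d), mem_filter.2 ⟨mem_univ _, hinj⟩, a, a', ha, fun x => ?_⟩
    convert hdeg x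
  · simp only [bernoulliProb, ZMod.card]
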